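/- The space Λ_Leb of C¹ orientation-preserving uniformly expanding degree-2 circle maps preserving Lebesgue measure (with the C¹ topology) has fundamental group isomorphic to ℤ. -/

import Mathlib

open MeasureTheory

namespace Stmt18

/-- Lifts of elements of `Λ_Leb`: pairs `(F, F')` where `F` is a lift of a C¹
orientation-preserving uniformly expanding degree-2 circle map preserving Lebesgue
(Haar) measure, and `F'` its derivative. -/
def LiftCond (p : C(ℝ, ℝ) × C(ℝ, ℝ)) : Prop :=
  ContDiff ℝ 1 p.1 ∧ (∀ x, deriv p.1 x = p.2 x) ∧
  (∃ l : ℝ, 1 < l ∧ ∀ x, l ≤ p.2 x) ∧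
  (∀ x, p.1 (x + 1) = p.1 x + 2) ∧
  ∀ g : UnitAddCircle → UnitAddCircle,
    (∀ x : ℝ, g (x : UnitAddCircle) = ((p.1 x : ℝ) : UnitAddCircle)) →
      Measure.map g volume = volume

def LiftSpace := {p : C(ℝ, ℝ) × C(ℝ, ℝ) // LiftCond p}

instance : TopologicalSpace LiftSpace :=
  inferInstanceAs (TopologicalSpace {p : C(ℝ, ℝ) × C(ℝ, ℝ) // LiftCond p})

/-- Two lifts represent the same circle map iff they differ by an integer. -/
def liftSetoid : Setoid LiftSpace where
  r p q := ∃ n : ℤ, (∀ x, q.1.1 x = p.1.1 x + n) ∧ ∀ x, q.1.2 x = p.1.2 x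
  iseqv := by
    refine ⟨fun p => ⟨0, fun x => by simp, fun x => rfl⟩, ?_, ?_⟩
    · rintro p q ⟨n, h1, h2⟩
      exact ⟨-n, fun x => by have := h1 x; push_cast; linarith, fun x => (h2 x).symm⟩
    · rintro p q r ⟨n, h1, h2⟩ ⟨m, g1, g2⟩
      exact ⟨n + m, fun x => by have := h1 x; have := g1 x; push_cast; linarith,
        fun x => (g2 x).trans (h2 x)⟩

/-- The space `Λ_Leb` with the C¹ topology. -/
def LambdaLeb := Quotient liftSetoid

instance : TopologicalSpace LambdaLeb :=
  inferInstanceAs (TopologicalSpace (Quotient liftSetoid))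

section Measure

variable {F G : ℝ → ℝ}

/-- The pushforward under `F` of Lebesgue measure on a fundamental domain, with the part carried
by `(1, 2]` translated back to `(0, 1]`. Here `G` is the inverse of `F`. -/
noncomputable def foldedMeasure (F G : ℝ → ℝ) : Measure ℝ :=
  Measure.map F (volume.restrict (Set.Ioc (G 0) (G 1))) +
    Measure.map (fun x => F x - 1) (volume.restrict (Set.Ioc (G 1) (G 2)))

theorem foldedMeasure_Iic (hF : Continuous F) (hG : StrictMono G) (hGF : ∀ x, G (F x) = x)
    (y : ℝ) : foldedMeasure F G (Set.Iic y) =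
      ENNReal.ofReal (min (G y) (G 1) - G 0) + ENNReal.ofReal (min (G (y + 1)) (G 2) - G 1) := by
  have h1 : F ⁻¹' Set.Iic y ∩ Set.Ioc (G 0) (G 1) = Set.Ioc (G 0) (min (G y) (G 1)) := by
    ext x
    have : F x ≤ y ↔ x ≤ G y := by rw [← hG.le_iff_le, hGF]
    simp only [Set.mem_inter_iff, Set.mem_preimage, Set.mem_Iic, Set.mem_Ioc, le_min_iff, this]
    tauto
  have h2 : (fun x => F x - 1) ⁻¹' Set.Iic y ∩ Set.Ioc (G 1) (G 2) =
      Set.Ioc (G 1) (min (G (y + 1)) (G 2)) := by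
    ext x
    have : F x ≤ y + 1 ↔ x ≤ G (y + 1) := by rw [← hG.le_iff_le, hGF]
    simp only [Set.mem_inter_iff, Set.mem_preimage, Set.mem_Iic, Set.mem_Ioc, le_min_iff,
      sub_le_iff_le_add, this]
    tauto
  have hF' : Measurable fun x => F x - 1 := (hF.sub continuous_const).measurable
  rw [foldedMeasure, Measure.add_apply, Measure.map_apply hF.measurable measurableSet_Iic,
    Measure.map_apply hF' measurableSet_Iic,
    Measure.restrict_apply (hF.measurable measurableSet_Iic),
    Measure.restrict_apply (hF' measurableSet_Iic), h1, h2, Real.volume_Ioc, Real.volume_Ioc]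

theorem foldedMeasure_ae_mem (hF : Continuous F) (hG : StrictMono G) (hFG : ∀ y, F (G y) = y)
    (hGF : ∀ x, G (F x) = x) : ∀ᵐ x ∂foldedMeasure F G, x ∈ Set.Ioc (0 : ℝ) (0 + 1) := by
  have hF' : Measurable fun x => F x - 1 := (hF.sub continuous_const).measurable
  have mono : StrictMono F := fun a b hab => by rwa [← hG.lt_iff_lt, hGF, hGF]
  rw [foldedMeasure, ae_add_measure_iff]
  constructor
  · refine (ae_map_iff hF.aemeasurable measurableSet_Ioc).2 ?_
    filter_upwards [ae_restrict_mem measurableSet_Ioc] with x hx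
    have h1 := mono hx.1
    have h2 := mono.monotone hx.2
    rw [hFG] at h1 h2
    constructor <;> linarith
  · refine (ae_map_iff hF'.aemeasurable measurableSet_Ioc).2 ?_
    filter_upwards [ae_restrict_mem measurableSet_Ioc] with x hx
    have h1 := mono hx.1
    have h2 := mono.monotone hx.2
    rw [hFG] at h1 h2
    constructor <;> linarith

theorem inverse_add_two (hFG : ∀ y, F (G y) = y) (hGF : ∀ x, G (F x) = x)
    (hper : ∀ x, F (x + 1) = F x + 2) (y : ℝ) : G (y + 2) = G y + 1 := by
  rw [← hGF (G y + 1), hper, hFG]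

theorem map_mk_foldedMeasure (hF : Continuous F) (hG : StrictMono G) (hFG : ∀ y, F (G y) = y)
    (hGF : ∀ x, G (F x) = x) (hper : ∀ x, F (x + 1) = F x + 2) {g : UnitAddCircle → UnitAddCircle}
    (hg : ∀ x : ℝ, g (x : UnitAddCircle) = ((F x : ℝ) : UnitAddCircle)) :
    Measure.map g volume =
      Measure.map ((↑) : ℝ → UnitAddCircle) (foldedMeasure F G) := by
  have hmk : Measurable ((↑) : ℝ → UnitAddCircle) := AddCircle.measurable_mk'
  have hF' : Measurable fun x => F x - 1 := (hF.sub continuous_const).measurable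
  have hgc : Continuous g := by
    refine (QuotientAddGroup.isQuotientMap_mk
      (N := AddSubgroup.zmultiples (1 : ℝ))).continuous_iff.2 ?_
    exact ((AddCircle.continuous_mk' (1 : ℝ)).comp hF).congr fun x => (hg x).symm
  have hsplit : volume.restrict (Set.Ioc (G 0) (G 0 + 1)) =
      (volume : Measure ℝ).restrict (Set.Ioc (G 0) (G 1)) +
        volume.restrict (Set.Ioc (G 1) (G 2)) := by
    have h2 : G 0 + 1 = G 2 := by rw [← inverse_add_two hFG hGF hper 0, zero_add]
    rw [h2, ← Set.Ioc_union_Ioc_eq_Ioc (hG zero_lt_one).le (hG one_lt_two).le]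
    refine Measure.restrict_union ?_ measurableSet_Ioc
    exact Set.Ioc_disjoint_Ioc_of_le le_rfl
  have hcomp : g ∘ ((↑) : ℝ → UnitAddCircle) = ((↑) : ℝ → UnitAddCircle) ∘ F := funext hg
  have hshift : ((↑) : ℝ → UnitAddCircle) ∘ F =
      ((↑) : ℝ → UnitAddCircle) ∘ fun x => F x - 1 := by
    funext x
    simp only [Function.comp, AddCircle.coe_sub]
    rw [AddCircle.coe_period, sub_zero]
  rw [← (UnitAddCircle.measurePreserving_mk (G 0)).map_eq, Measure.map_map hgc.measurable hmk,
    hcomp, hsplit, Measure.map_add _ _ (hmk.comp hF.measurable), foldedMeasure,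
    Measure.map_add _ _ hmk, Measure.map_map hmk hF.measurable, Measure.map_map hmk hF',
    ← hshift]

theorem eq_of_map_mk_eq {μ ν : Measure ℝ} (hμ : ∀ᵐ x ∂μ, x ∈ Set.Ioc (0 : ℝ) (0 + 1))
    (hν : ∀ᵐ x ∂ν, x ∈ Set.Ioc (0 : ℝ) (0 + 1))
    (h : Measure.map ((↑) : ℝ → UnitAddCircle) μ = Measure.map ((↑) : ℝ → UnitAddCircle) ν) :
    μ = ν := by
  have hmk : Measurable ((↑) : ℝ → UnitAddCircle) := AddCircle.measurable_mk'
  set e : UnitAddCircle → ℝ := fun z => (AddCircle.measurableEquivIoc 1 0 z : ℝ)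
  have he : Measurable e := measurable_subtype_coe.comp (MeasurableEquiv.measurable _)
  have hid : ∀ x ∈ Set.Ioc (0 : ℝ) (0 + 1), e (x : UnitAddCircle) = x := fun x hx => by
    change ((AddCircle.equivIoc 1 0 (x : UnitAddCircle) : Set.Ioc (0 : ℝ) (0 + 1)) : ℝ) = x
    rw [AddCircle.equivIoc_coe_of_mem]
    exact hx
  have key : ∀ ρ : Measure ℝ, (∀ᵐ x ∂ρ, x ∈ Set.Ioc (0 : ℝ) (0 + 1)) →
      Measure.map e (Measure.map ((↑) : ℝ → UnitAddCircle) ρ) = ρ := fun ρ hρ => by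
    rw [Measure.map_map he hmk]
    conv_rhs => rw [← Measure.map_id (μ := ρ)]
    refine Measure.map_congr ?_
    filter_upwards [hρ] with x hx using hid x hx
  rw [← key μ hμ, h, key ν hν]

/-- A degree-two circle map with lift `F`, invertible with inverse `G`, preserves Lebesgue measure iff
the two inverse branches add up to a translation. -/
theorem preserves_volume_iff (hF : Continuous F) (hG : StrictMono G) (hFG : ∀ y, F (G y) = y)
    (hGF : ∀ x, G (F x) = x) (hper : ∀ x, F (x + 1) = F x + 2) :
    (∀ g : UnitAddCircle → UnitAddCircle,
      (∀ x : ℝ, g (x : UnitAddCircle) = ((F x : ℝ) : UnitAddCircle)) →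
        Measure.map g volume = volume) ↔ ∃ c, ∀ y, G y + G (y + 1) = y + c := by
  have hper' := inverse_add_two hFG hGF hper
  have hvol : Measure.map ((↑) : ℝ → UnitAddCircle) (volume.restrict (Set.Ioc (0 : ℝ) (0 + 1))) =
      volume := (UnitAddCircle.measurePreserving_mk 0).map_eq
  have hfold : ∀ y, foldedMeasure F G (Set.Iic y) = _ := foldedMeasure_Iic hF hG hGF
  have hIic : ∀ y : ℝ, (volume.restrict (Set.Ioc (0 : ℝ) (0 + 1))) (Set.Iic y) =
      ENNReal.ofReal (min y 1) := fun y => by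
    rw [Measure.restrict_apply measurableSet_Iic, Set.inter_comm, Set.Ioc_inter_Iic,
      Real.volume_Ioc, zero_add, sub_zero, min_comm]
  have h2 : G 2 = G 0 + 1 := by rw [← hper' 0, zero_add]
  constructor
  · intro h
    have hp : Function.Periodic (fun x => ((F x : ℝ) : UnitAddCircle)) 1 := fun x => by
      simp only [hper]
      have : ((2 : ℝ) : UnitAddCircle) = 0 := by
        rw [AddCircle.coe_eq_zero_iff]; exact ⟨2, by norm_num⟩
      rw [AddCircle.coe_add, this, add_zero]
    have hmap := h hp.lift fun x => hp.lift_coe x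
    rw [map_mk_foldedMeasure hF hG hFG hGF hper fun x => hp.lift_coe x, ← hvol] at hmap
    have heq := eq_of_map_mk_eq (foldedMeasure_ae_mem hF hG hFG hGF)
      (ae_restrict_mem measurableSet_Ioc) hmap
    have key : ∀ y ∈ Set.Ico (0 : ℝ) 1, G y + G (y + 1) - y = G 0 + G 1 := fun y hy => by
      have h1 := hfold y
      rw [heq, hIic, min_eq_left hy.2.le, min_eq_left (hG.monotone hy.2.le),
        min_eq_left (hG.monotone (by linarith [hy.2])), ← ENNReal.ofReal_add
          (sub_nonneg.2 (hG.monotone hy.1)) (sub_nonneg.2 (hG.monotone (by linarith [hy.1]))),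
        ENNReal.ofReal_eq_ofReal_iff hy.1 (add_nonneg
          (sub_nonneg.2 (hG.monotone hy.1)) (sub_nonneg.2 (hG.monotone (by linarith [hy.1]))))]
        at h1
      linarith
    refine ⟨G 0 + G 1, fun y => ?_⟩
    have hperiodic : Function.Periodic (fun y => G y + G (y + 1) - y) 1 := fun y => by
      have : y + 1 + 1 = y + 2 := by ring
      simp only [this, hper']
      ring
    obtain ⟨z, hz, hyz⟩ := hperiodic.exists_mem_Ico₀ one_pos y
    have := key z hz
    linarith
  · rintro ⟨c, hc⟩ g hg
    rw [map_mk_foldedMeasure hF hG hFG hGF hper hg, ← hvol]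
    congr 1
    symm
    refine Measure.ext_of_Iic _ _ fun y => ?_
    rw [hIic, hfold]
    have hc0 := hc 0
    rw [zero_add] at hc0
    have hcy := hc y
    rcases le_or_gt y 0 with h0 | h0
    · rw [ENNReal.ofReal_of_nonpos (min_le_of_left_le h0), ENNReal.ofReal_of_nonpos,
        ENNReal.ofReal_of_nonpos, add_zero]
      · exact sub_nonpos.2 (min_le_of_left_le (hG.monotone (by linarith)))
      · exact sub_nonpos.2 (min_le_of_left_le (hG.monotone h0))
    have g01 := hG zero_lt_one
    have g12 := hG one_lt_two
    rcases le_or_gt y 1 with h1 | h1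
    · have a1 := hG h0
      have a2 : G 1 < G (y + 1) := hG (by linarith)
      rw [min_eq_left h1, min_eq_left (hG.monotone h1), min_eq_left (hG.monotone (by linarith)),
        ← ENNReal.ofReal_add (by linarith) (by linarith)]
      congr 1
      linarith
    · rw [min_eq_right h1.le, min_eq_right (hG.monotone h1.le),
        min_eq_right (hG.monotone (by linarith)),
        ← ENNReal.ofReal_add (by linarith) (by linarith)]
      congr 1
      linarith

end Measure

section Inverse

theorem surjective_of_monotone_sub {f : ℝ → ℝ} {c : ℝ} (hf : Continuous f) (hc : 0 < c)
    (h : Monotone fun x => f x - c * x) : Function.Surjective f := by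
  have hlin : Filter.Tendsto (fun x : ℝ => f 0 + c * x) Filter.atTop Filter.atTop :=
    Filter.tendsto_atTop_add_const_left _ _ (Filter.tendsto_id.const_mul_atTop hc)
  have hlin' : Filter.Tendsto (fun x : ℝ => f 0 + c * x) Filter.atBot Filter.atBot :=
    Filter.tendsto_atBot_add_const_left _ _ (Filter.tendsto_id.const_mul_atBot hc)
  refine hf.surjective (Filter.tendsto_atTop_mono' _ ?_ hlin)
    (Filter.tendsto_atBot_mono' _ ?_ hlin')
  · filter_upwards [Filter.eventually_ge_atTop 0] with x hx
    have := h hx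
    simp only [mul_zero] at this
    linarith
  · filter_upwards [Filter.eventually_le_atBot 0] with x hx
    have := h hx
    simp only [mul_zero] at this
    linarith

theorem strictMono_of_monotone_sub {f : ℝ → ℝ} {c : ℝ} (hc : 0 < c)
    (h : Monotone fun x => f x - c * x) : StrictMono f := fun x y hxy => by
  have h1 := h hxy.le
  have h2 := mul_lt_mul_of_pos_left hxy hc
  simp only at h1
  linarith

/-- Inverses of a continuous family of increasing functions depend jointly continuously on the
parameter and the point. -/
theorem continuous_uncurry_inverse {X : Type*} [TopologicalSpace X] {Φ Ψ : X → ℝ → ℝ}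
    (hΦ : Continuous (Function.uncurry Φ)) (hmono : ∀ a, StrictMono (Φ a))
    (hinv : ∀ a y, Φ a (Ψ a y) = y) : Continuous (Function.uncurry Ψ) := by
  have hslice : ∀ u : ℝ, Continuous fun q : X × ℝ => Φ q.1 u := fun u =>
    hΦ.comp (continuous_fst.prodMk continuous_const)
  rw [continuous_iff_continuousAt]
  rintro ⟨a, y⟩
  refine tendsto_order.2 ⟨fun u hu => ?_, fun u hu => ?_⟩
  · have h1 : Φ a u < y := by rw [← hinv a y]; exact hmono a hu
    filter_upwards [(hslice u).continuousAt.eventually_lt continuous_snd.continuousAt h1] with q hq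
    rw [← hinv q.1 q.2] at hq
    exact (hmono q.1).lt_iff_lt.1 hq
  · have h1 : y < Φ a u := by rw [← hinv a y]; exact hmono a hu
    filter_upwards [continuous_snd.continuousAt.eventually_lt (hslice u).continuousAt h1] with q hq
    rw [← hinv q.1 q.2] at hq
    exact (hmono q.1).lt_iff_lt.1 hq

end Inverse

namespace LiftSpace

theorem continuous_val : Continuous fun p : LiftSpace => p.1 := continuous_subtype_val

theorem continuous_eval : Continuous fun q : LiftSpace × ℝ => q.1.1.1 q.2 :=
  ((continuous_fst.comp (continuous_val.comp continuous_fst)).eval continuous_snd :)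

theorem continuous_eval_deriv : Continuous fun q : LiftSpace × ℝ => q.1.1.2 q.2 :=
  ((continuous_snd.comp (continuous_val.comp continuous_fst)).eval continuous_snd :)

variable (p : LiftSpace)

theorem hasDerivAt (x : ℝ) : HasDerivAt p.1.1 (p.1.2 x) x := by
  have h := ((p.2.1.differentiable one_ne_zero) x).hasDerivAt
  rwa [p.2.2.1 x] at h

theorem one_lt_deriv (x : ℝ) : 1 < p.1.2 x := by
  obtain ⟨l, hl, h⟩ := p.2.2.2.1
  exact hl.trans_le (h x)

theorem map_add_one (x : ℝ) : p.1.1 (x + 1) = p.1.1 x + 2 := p.2.2.2.2.1 x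

theorem monotone_sub_id : Monotone fun x => p.1.1 x - 1 * x := by
  have hd : ∀ x, HasDerivAt (fun x => p.1.1 x - 1 * x) (p.1.2 x - 1 * 1) x := fun x =>
    (p.hasDerivAt x).sub ((hasDerivAt_id x).const_mul 1)
  refine monotone_of_deriv_nonneg (fun x => (hd x).differentiableAt) fun x => ?_
  rw [(hd x).deriv]
  linarith [p.one_lt_deriv x]

theorem strictMono : StrictMono p.1.1 := strictMono_of_monotone_sub one_pos p.monotone_sub_id

theorem surjective : Function.Surjective p.1.1 :=
  surjective_of_monotone_sub p.1.1.continuous one_pos p.monotone_sub_id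

/-- The straight-line homotopy from the identity to `F / 2`. Precomposed with `F⁻¹`, it is the
straight-line homotopy from `F⁻¹` to the inverse of `x ↦ 2 * x`. -/
noncomputable def blend (t : unitInterval) (p : LiftSpace) (u : ℝ) : ℝ :=
  (1 - t) * u + t * (p.1.1 u / 2)

theorem continuous_blend :
    Continuous (Function.uncurry fun q : unitInterval × LiftSpace => blend q.1 q.2) := by
  have h : Continuous fun q : (unitInterval × LiftSpace) × ℝ => q.1.2.1.1 q.2 :=
    continuous_eval.comp ((continuous_snd.comp continuous_fst).prodMk continuous_snd)
  have ht : Continuous fun q : (unitInterval × LiftSpace) × ℝ => (q.1.1 : ℝ) := by fun_prop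
  exact ((continuous_const.sub ht).mul continuous_snd).add (ht.mul (h.div_const 2))

variable (t : unitInterval)

theorem continuous_blend_right : Continuous (blend t p) :=
  continuous_blend.comp (continuous_const.prodMk continuous_id : Continuous fun u => ((t, p), u))

theorem monotone_blend_sub : Monotone fun u => blend t p u - 1 / 2 * u := fun u v huv => by
  have h := p.monotone_sub_id huv
  have ht0 := t.2.1
  have ht1 := t.2.2
  simp only [blend] at h ⊢
  nlinarith [mul_le_mul_of_nonneg_left h ht0,
    mul_le_mul_of_nonneg_left huv (sub_nonneg.2 ht1)]

theorem strictMono_blend : StrictMono (blend t p) :=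
  strictMono_of_monotone_sub one_half_pos (monotone_blend_sub p t)

theorem surjective_blend : Function.Surjective (blend t p) :=
  surjective_of_monotone_sub (continuous_blend_right p t) one_half_pos (monotone_blend_sub p t)

/-- The inverse of `blend t p`. -/
noncomputable def blendInv (t : unitInterval) (p : LiftSpace) : ℝ → ℝ :=
  Function.surjInv (surjective_blend p t)

theorem blend_blendInv (x : ℝ) : blend t p (blendInv t p x) = x :=
  Function.surjInv_eq (surjective_blend p t) x

theorem blendInv_blend (u : ℝ) : blendInv t p (blend t p u) = u :=
  (strictMono_blend p t).injective (blend_blendInv p t _)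

theorem continuous_blendInv :
    Continuous (Function.uncurry fun q : unitInterval × LiftSpace => blendInv q.1 q.2) :=
  continuous_uncurry_inverse continuous_blend (fun q => strictMono_blend q.2 q.1)
    fun q => blend_blendInv q.2 q.1

theorem continuous_blendInv_right : Continuous (blendInv t p) :=
  continuous_blendInv.comp
    (continuous_const.prodMk continuous_id : Continuous fun u => ((t, p), u))

/-- The derivative of `blend t p`. -/
noncomputable def blendDeriv (t : unitInterval) (p : LiftSpace) (u : ℝ) : ℝ :=
  (1 - t) + t * (p.1.2 u / 2)

theorem hasDerivAt_blend (u : ℝ) : HasDerivAt (blend t p) (blendDeriv t p u) u := by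
  have h := ((hasDerivAt_id u).const_mul (1 - (t : ℝ))).add
    (((p.hasDerivAt u).div_const 2).const_mul (t : ℝ))
  rw [mul_one] at h
  exact h

theorem blendDeriv_pos (u : ℝ) : 0 < blendDeriv t p u := by
  have h := p.one_lt_deriv u
  have ht0 := t.2.1
  have ht1 := t.2.2
  simp only [blendDeriv]
  nlinarith [mul_nonneg ht0 (sub_nonneg.2 h.le)]

theorem continuous_contractFun : Continuous
    (Function.uncurry fun (q : unitInterval × LiftSpace) x => q.2.1.1 (blendInv q.1 q.2 x)) :=
  continuous_eval.comp ((continuous_snd.comp continuous_fst).prodMk continuous_blendInv)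

theorem continuous_contractDeriv : Continuous
    (Function.uncurry fun (q : unitInterval × LiftSpace) x =>
      q.2.1.2 (blendInv q.1 q.2 x) / blendDeriv q.1 q.2 (blendInv q.1 q.2 x)) := by
  have h : Continuous fun q : (unitInterval × LiftSpace) × ℝ =>
      q.1.2.1.2 (blendInv q.1.1 q.1.2 q.2) :=
    continuous_eval_deriv.comp ((continuous_snd.comp continuous_fst).prodMk continuous_blendInv)
  have ht : Continuous fun q : (unitInterval × LiftSpace) × ℝ => (q.1.1 : ℝ) := by fun_prop
  exact h.div ((continuous_const.sub ht).add (ht.mul (h.div_const 2)))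
    fun q => (blendDeriv_pos _ _ _).ne'

/-- The map `F ∘ (blend t p)⁻¹` with its derivative. -/
noncomputable def contractPair (t : unitInterval) (p : LiftSpace) : C(ℝ, ℝ) × C(ℝ, ℝ) :=
  (⟨fun x => p.1.1 (blendInv t p x), p.1.1.continuous.comp (continuous_blendInv_right p t)⟩,
    ⟨fun x => p.1.2 (blendInv t p x) / blendDeriv t p (blendInv t p x),
      continuous_contractDeriv.comp
        (continuous_const.prodMk continuous_id : Continuous fun u => ((t, p), u))⟩)

theorem hasDerivAt_contractPair (x : ℝ) :
    HasDerivAt (contractPair t p).1 ((contractPair t p).2 x) x := by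
  have h := HasDerivAt.of_local_left_inverse (continuous_blendInv_right p t).continuousAt
    (hasDerivAt_blend p t (blendInv t p x)) (blendDeriv_pos p t _).ne'
    (Filter.Eventually.of_forall (blend_blendInv p t))
  exact (p.hasDerivAt (blendInv t p x)).comp x h

theorem blendInv_add_one (x : ℝ) : blendInv t p (x + 1) = blendInv t p x + 1 := by
  apply (strictMono_blend p t).injective
  rw [blend_blendInv]
  conv_lhs => rw [← blend_blendInv p t x]
  simp only [blend, p.map_add_one]
  ring

/-- The inverse branches of a measure-preserving lift add up to a translation. -/
theorem exists_inverse : ∃ G : ℝ → ℝ, (∀ y, p.1.1 (G y) = y) ∧ (∀ x, G (p.1.1 x) = x) ∧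
    StrictMono G ∧ ∃ c, ∀ y, G y + G (y + 1) = y + c := by
  obtain ⟨G, hFG⟩ : ∃ G : ℝ → ℝ, ∀ y, p.1.1 (G y) = y :=
    ⟨_, Function.surjInv_eq p.surjective⟩
  have hGF : ∀ x, G (p.1.1 x) = x := fun x => p.strictMono.injective (hFG _)
  have hG : StrictMono G := fun a b hab => by
    apply p.strictMono.lt_iff_lt.1
    rwa [hFG, hFG]
  exact ⟨G, hFG, hGF, hG, (preserves_volume_iff p.1.1.continuous hG hFG hGF p.map_add_one).1
    p.2.2.2.2.2⟩

theorem liftCond_contractPair : LiftCond (contractPair t p) := by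
  have hd := hasDerivAt_contractPair p t
  have hderiv : deriv (contractPair t p).1 = (contractPair t p).2 := funext fun x => (hd x).deriv
  have hper : ∀ x, (contractPair t p).1 (x + 1) = (contractPair t p).1 x + 2 := fun x => by
    change p.1.1 (blendInv t p (x + 1)) = p.1.1 (blendInv t p x) + 2
    rw [blendInv_add_one, p.map_add_one]
  refine ⟨contDiff_one_iff_deriv.2 ⟨fun x => (hd x).differentiableAt, ?_⟩,
    fun x => (hd x).deriv, ?_, hper, ?_⟩
  · rw [hderiv]
    exact (contractPair t p).2.continuous
  · obtain ⟨l, hl, h⟩ := p.2.2.2.1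
    refine ⟨min l 2, lt_min hl one_lt_two, fun x => ?_⟩
    change _ ≤ p.1.2 (blendInv t p x) / blendDeriv t p (blendInv t p x)
    rw [le_div_iff₀ (blendDeriv_pos p t _)]
    have h1 := (min_le_left l 2).trans (h (blendInv t p x))
    have h2 := min_le_right l 2
    have h3 := p.one_lt_deriv (blendInv t p x)
    simp only [blendDeriv]
    nlinarith [mul_le_mul_of_nonneg_left h1 (sub_nonneg.2 t.2.2),
      mul_le_mul_of_nonneg_left h2 (mul_nonneg t.2.1 (zero_le_one.trans h3.le))]
  · obtain ⟨G, hFG, hGF, hG, c, hc⟩ := p.exists_inverse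
    refine (preserves_volume_iff (G := fun y => blend t p (G y)) (contractPair t p).1.continuous
      ((strictMono_blend p t).comp hG) (fun y => ?_) (fun x => ?_) hper).2
      ⟨(1 - t) * c + t / 2, fun y => ?_⟩
    · change p.1.1 (blendInv t p (blend t p (G y))) = y
      rw [blendInv_blend, hFG]
    · change blend t p (G (p.1.1 (blendInv t p x))) = x
      rw [hGF, blend_blendInv]
    · simp only [blend, hFG]
      linear_combination (1 - (t : ℝ)) * hc y

/-- A contraction of `LiftSpace` to the lift `x ↦ 2 * x` of the doubling map. -/
noncomputable def contract (t : unitInterval) (p : LiftSpace) : LiftSpace :=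
  ⟨contractPair t p, liftCond_contractPair p t⟩

theorem continuous_contract :
    Continuous fun q : unitInterval × LiftSpace => contract q.1 q.2 := by
  refine Continuous.subtype_mk (Continuous.prodMk ?_ ?_) _
  · exact ContinuousMap.continuous_of_continuous_uncurry _ continuous_contractFun
  · exact ContinuousMap.continuous_of_continuous_uncurry _ continuous_contractDeriv

theorem contract_zero : contract 0 p = p := by
  have h : ∀ x, blendInv 0 p x = x := fun x => by
    simpa [blend] using blend_blendInv p 0 x
  refine Subtype.ext (Prod.ext (ContinuousMap.ext fun x => ?_) (ContinuousMap.ext fun x => ?_))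
  · change p.1.1 (blendInv 0 p x) = _
    rw [h]
  · change p.1.2 (blendInv 0 p x) / blendDeriv 0 p (blendInv 0 p x) = _
    simp [h, blendDeriv]

theorem contract_one (p q : LiftSpace) : contract 1 p = contract 1 q := by
  have h : ∀ (p : LiftSpace) x, p.1.1 (blendInv 1 p x) = 2 * x := fun p x => by
    have := blend_blendInv p 1 x
    simp only [blend, Set.Icc.coe_one, sub_self, zero_mul, zero_add, one_mul] at this
    linarith
  have h' : ∀ (p : LiftSpace) x, p.1.2 (blendInv 1 p x) / blendDeriv 1 p (blendInv 1 p x) = 2 :=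
    fun p x => by
      have := zero_lt_one.trans (p.one_lt_deriv (blendInv 1 p x))
      simp only [blendDeriv, Set.Icc.coe_one, sub_self, zero_add, one_mul]
      field_simp
  refine Subtype.ext (Prod.ext (ContinuousMap.ext fun x => ?_) (ContinuousMap.ext fun x => ?_))
  · exact (h p x).trans (h q x).symm
  · exact (h' p x).trans (h' q x).symm

theorem contractibleSpace (p : LiftSpace) : ContractibleSpace LiftSpace := by
  rw [contractible_iff_id_nullhomotopic]
  exact ⟨contract 1 p, ⟨{
    toFun := fun q => contract q.1 q.2
    continuous_toFun := continuous_contract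
    map_zero_left := contract_zero
    map_one_left := fun q => contract_one q p }⟩⟩

/-- Translation of lifts by integers, the deck group of `LiftSpace → LambdaLeb`. -/
noncomputable instance : AddAction ℤ LiftSpace where
  vadd n p := ⟨(p.1.1 + ContinuousMap.const ℝ (n : ℝ), p.1.2), by
    obtain ⟨h1, h2, h3, h4, h5⟩ := p.2
    refine ⟨h1.add contDiff_const, fun x => ?_, h3, fun x => ?_, fun g hg => h5 g fun x => ?_⟩
    · rw [← h2 x]
      exact deriv_add_const (n : ℝ)
    · simp only [ContinuousMap.add_apply, ContinuousMap.const_apply, h4]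
      ring
    · rw [hg x, ContinuousMap.add_apply, ContinuousMap.const_apply, AddCircle.coe_add]
      have : ((n : ℝ) : UnitAddCircle) = 0 := AddCircle.coe_eq_zero_iff 1 |>.2 ⟨n, by simp⟩
      rw [this, add_zero]⟩
  zero_vadd p := Subtype.ext (Prod.ext (ContinuousMap.ext fun x => by
    change p.1.1 x + ((0 : ℤ) : ℝ) = p.1.1 x
    simp) rfl)
  add_vadd m n p := Subtype.ext (Prod.ext (ContinuousMap.ext fun x => by
    change p.1.1 x + ((m + n : ℤ) : ℝ) = p.1.1 x + (n : ℝ) + (m : ℝ)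
    push_cast
    ring) rfl)

theorem vadd_apply (n : ℤ) (x : ℝ) : (n +ᵥ p).1.1 x = p.1.1 x + n := rfl

theorem vadd_deriv (n : ℤ) : (n +ᵥ p).1.2 = p.1.2 := rfl

theorem isAddQuotientCoveringMap :
    IsAddQuotientCoveringMap (Quotient.mk liftSetoid : LiftSpace → LambdaLeb) ℤ where
  toIsQuotientMap := isQuotientMap_quotient_mk'
  continuous_const_vadd n := by
    refine Continuous.subtype_mk (Continuous.prodMk ?_ ?_) _
    · exact (continuous_fst.comp continuous_val).add continuous_const
    · exact continuous_snd.comp continuous_val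
  apply_eq_iff_mem_orbit {p q} := by
    rw [Quotient.eq_iff_equiv]
    constructor
    · rintro ⟨n, h1, h2⟩
      refine ⟨-n, Subtype.ext (Prod.ext (ContinuousMap.ext fun x => ?_)
        (ContinuousMap.ext h2))⟩
      change q.1.1 x + ((-n : ℤ) : ℝ) = p.1.1 x
      rw [h1]
      push_cast
      ring
    · rintro ⟨n, rfl⟩
      refine ⟨-n, fun x => ?_, fun x => rfl⟩
      change q.1.1 x = q.1.1 x + (n : ℝ) + ((-n : ℤ) : ℝ)
      push_cast
      ring
  disjoint p := by
    have hev : Continuous fun q : LiftSpace => q.1.1 0 :=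
      continuous_eval.comp (continuous_id.prodMk continuous_const)
    refine ⟨(fun q : LiftSpace => q.1.1 0) ⁻¹' Metric.ball (p.1.1 0) (1 / 2),
      hev.continuousAt.preimage_mem_nhds (Metric.ball_mem_nhds _ one_half_pos), ?_⟩
    rintro n ⟨_, ⟨q, hq, rfl⟩, hq'⟩
    simp only [Set.mem_preimage, Metric.mem_ball, Real.dist_eq, abs_lt, vadd_apply] at hq hq'
    have h1 : (-1 : ℝ) < n := by linarith [hq.1, hq.2, hq'.1]
    have h2 : (n : ℝ) < 1 := by linarith [hq.1, hq.2, hq'.2]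
    have h1' : -1 < n := by exact_mod_cast h1
    have h2' : n < 1 := by exact_mod_cast h2
    omega

end LiftSpace

/-- the fundamental group of `Λ_Leb` is `ℤ`. -/
theorem stmt18 :
    ∀ x : LambdaLeb, Nonempty (FundamentalGroup LambdaLeb x ≃* Multiplicative ℤ) := by
  intro x
  obtain ⟨p, hp⟩ := LiftSpace.isAddQuotientCoveringMap.surjective x
  have := p.contractibleSpace
  exact ⟨(LiftSpace.isAddQuotientCoveringMap.fundamentalGroupEquiv ⟨p, hp⟩).trans
    MulOpposite.opMulEquiv.symm⟩

end Stmt18
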